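/- Let F : ℝ^d → ℝ be convex and twice continuously differentiable with Hessian L-Lipschitz in spectral norm, let r : ℝ^d → ℝ be convex, and let w* be a global minimizer of F + r. Fix w_t, let H_t = ∇²F(w_t) be symmetric positive definite with condition number κ_t = σ_max(H_t)/σ_min(H_t), and let ε ∈ (0, 1/2]. Suppose a symmetric positive definite matrix H̃_t satisfies (1−ε)H_t ⪯ H̃_t ⪯ (1+ε)H_t, and define w_{t+1} as the global minimizer of z ↦ (1/2)‖z − (w_t − H̃_t⁻¹∇F(w_t))‖_{H̃_t}² + r(z). Then ‖w_{t+1} − w*‖₂ ≤ 2ε·√κ_t·‖w_t − w*‖₂ + (L/σ_min(H_t))·‖w_t − w*‖₂². -/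

import Mathlib

open Matrix
open scoped RealInnerProductSpace

noncomputable section

/-- The `H`-weighted norm `‖x‖_H = √(xᵀHx)` of a vector in Euclidean space. -/
def normHE {d : ℕ} (H : Matrix (Fin d) (Fin d) ℝ) (x : EuclideanSpace ℝ (Fin d)) : ℝ :=
  Real.sqrt ⟪x, Matrix.toEuclideanLin H x⟫

/-- The smallest eigenvalue of a Hermitian matrix. -/
def sMin {d : ℕ} {H : Matrix (Fin d) (Fin d) ℝ} (hH : H.IsHermitian) : ℝ :=
  ⨅ i, hH.eigenvalues i

/-- The largest eigenvalue of a Hermitian matrix. -/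
def sMax {d : ℕ} {H : Matrix (Fin d) (Fin d) ℝ} (hH : H.IsHermitian) : ℝ :=
  ⨆ i, hH.eigenvalues i

lemma aux_min (f : ℝ → ℝ) (f' c : ℝ) (hf : HasDerivAt f f' 0)
    (h : ∀ t : ℝ, 0 < t → t ≤ 1 → f 0 ≤ f t + t * c) : 0 ≤ f' + c := by
  have h1 := hf.tendsto_slope_zero_right
  have h2 : ∀ᶠ t : ℝ in nhdsWithin 0 (Set.Ioi 0), -c ≤ t⁻¹ • (f (0 + t) - f 0) := by
    filter_upwards [Ioc_mem_nhdsGT (show (0:ℝ) < 1 by norm_num)] with t ht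
    have := h t ht.1 ht.2
    rw [smul_eq_mul, zero_add, inv_mul_eq_div, le_div_iff₀ ht.1]
    linarith
  have := ge_of_tendsto h1 h2
  linarith

lemma aux_conv {E : Type*} [NormedAddCommGroup E] [NormedSpace ℝ E] (r G : E → ℝ)
    (hr : ConvexOn ℝ Set.univ r) (p q : E) (hp : ∀ z, G p + r p ≤ G z + r z) (f' : ℝ)
    (hf : HasDerivAt (fun t : ℝ => G (p + t • (q - p))) f' 0) : 0 ≤ f' + (r q - r p) := by
  refine aux_min _ _ _ hf ?_
  intro t h0 h1
  have h2 := hp (p + t • (q - p))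
  have h3 := hr.2 (Set.mem_univ p) (Set.mem_univ q) (sub_nonneg.2 h1) h0.le (by ring)
  have h4 : (1 - t) • p + t • q = p + t • (q - p) := by module
  rw [h4] at h3
  simp only [smul_eq_mul, zero_smul, add_zero] at *
  linarith

lemma aux_symm {d : ℕ} {A : Matrix (Fin d) (Fin d) ℝ} (hA : A.IsHermitian)
    (x y : EuclideanSpace ℝ (Fin d)) :
    ⟪Matrix.toEuclideanLin A x, y⟫ = ⟪x, Matrix.toEuclideanLin A y⟫ :=
  (Matrix.isSymmetric_toEuclideanLin_iff.2 hA) x y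

lemma aux_psd {d : ℕ} {A : Matrix (Fin d) (Fin d) ℝ} (hA : A.PosSemidef)
    (x : EuclideanSpace ℝ (Fin d)) : 0 ≤ ⟪x, Matrix.toEuclideanLin A x⟫ := by
  have := hA.dotProduct_mulVec_nonneg x.ofLp
  simp only [EuclideanSpace.inner_eq_star_dotProduct]
  rw [dotProduct_comm]
  simpa using this

lemma aux_spec {d : ℕ} {A : Matrix (Fin d) (Fin d) ℝ} (hA : A.IsHermitian)
    (x : EuclideanSpace ℝ (Fin d)) : ⟪x, Matrix.toEuclideanLin A x⟫ =
      ∑ i, hA.eigenvalues i * ⟪x, hA.eigenvectorBasis i⟫ ^ 2 := by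
  rw [← hA.eigenvectorBasis.sum_inner_mul_inner x]
  refine Finset.sum_congr rfl fun i _ => ?_
  have h : Matrix.toEuclideanLin A (hA.eigenvectorBasis i)
      = hA.eigenvalues i • hA.eigenvectorBasis i := by
    ext j
    have := congrFun (hA.mulVec_eigenvectorBasis i) j
    simpa [Matrix.toEuclideanLin] using this
  rw [← aux_symm hA, h, inner_smul_left, real_inner_comm x]
  simp only [conj_trivial]
  ring

lemma aux_norm {d : ℕ} {A : Matrix (Fin d) (Fin d) ℝ} (hA : A.IsHermitian)
    (x : EuclideanSpace ℝ (Fin d)) : ‖x‖ ^ 2 = ∑ i, ⟪x, hA.eigenvectorBasis i⟫ ^ 2 := by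
  rw [← real_inner_self_eq_norm_sq, ← hA.eigenvectorBasis.sum_inner_mul_inner x]
  refine Finset.sum_congr rfl fun i _ => ?_
  rw [real_inner_comm x]; ring

lemma aux_lo {d : ℕ} {A : Matrix (Fin d) (Fin d) ℝ} (hA : A.IsHermitian)
    (x : EuclideanSpace ℝ (Fin d)) : sMin hA * ‖x‖ ^ 2 ≤ ⟪x, Matrix.toEuclideanLin A x⟫ := by
  rw [aux_spec hA, aux_norm hA, Finset.mul_sum]
  refine Finset.sum_le_sum fun i _ => mul_le_mul_of_nonneg_right ?_ (sq_nonneg _)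
  exact ciInf_le (Set.finite_range _).bddBelow i

lemma aux_hi {d : ℕ} {A : Matrix (Fin d) (Fin d) ℝ} (hA : A.IsHermitian)
    (x : EuclideanSpace ℝ (Fin d)) : ⟪x, Matrix.toEuclideanLin A x⟫ ≤ sMax hA * ‖x‖ ^ 2 := by
  rw [aux_spec hA, aux_norm hA, Finset.mul_sum]
  refine Finset.sum_le_sum fun i _ => mul_le_mul_of_nonneg_right ?_ (sq_nonneg _)
  exact le_ciSup (Set.finite_range _).bddAbove i

lemma aux_sMin_pos {d : ℕ} [Nonempty (Fin d)] {A : Matrix (Fin d) (Fin d) ℝ} (hA : A.PosDef) :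
    0 < sMin hA.1 := by
  obtain ⟨i, hi⟩ := exists_eq_ciInf_of_finite (f := hA.1.eigenvalues)
  rw [sMin, ← hi]
  exact hA.eigenvalues_pos i

lemma aux_cs {d : ℕ} {A H : Matrix (Fin d) (Fin d) ℝ} (hA : A.IsHermitian) (ε : ℝ)
    (h1 : ∀ x, ⟪x, Matrix.toEuclideanLin A x⟫ ≤ ε * ⟪x, Matrix.toEuclideanLin H x⟫)
    (h2 : ∀ x, -(ε * ⟪x, Matrix.toEuclideanLin H x⟫) ≤ ⟪x, Matrix.toEuclideanLin A x⟫)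
    (x y : EuclideanSpace ℝ (Fin d)) (a b : ℝ) (ha : 0 < a) (hb : 0 < b)
    (hx : ⟪x, Matrix.toEuclideanLin H x⟫ = a ^ 2) (hy : ⟪y, Matrix.toEuclideanLin H y⟫ = b ^ 2) :
    ⟪y, Matrix.toEuclideanLin A x⟫ ≤ ε * a * b := by
  have e1 := h1 (b • x + a • y)
  have e2 := h2 (b • x - a • y)
  have hs : ⟪x, Matrix.toEuclideanLin A y⟫ = ⟪y, Matrix.toEuclideanLin A x⟫ := by
    rw [← aux_symm hA, real_inner_comm]
  simp only [map_add, map_sub, map_smul, inner_add_left, inner_add_right, inner_sub_left,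
    inner_sub_right, inner_smul_left, inner_smul_right, conj_trivial, hs, hx, hy] at e1 e2
  have hab : 0 < a * b := mul_pos ha hb
  refine le_of_mul_le_mul_left ?_ hab
  nlinarith

lemma aux_taylor {d : ℕ} (g : EuclideanSpace ℝ (Fin d) → EuclideanSpace ℝ (Fin d))
    (hg : Differentiable ℝ g) (L : ℝ)
    (Hess : EuclideanSpace ℝ (Fin d) → Matrix (Fin d) (Fin d) ℝ)
    (hHess : ∀ w y, fderiv ℝ g w y = Matrix.toEuclideanLin (Hess w) y)
    (hLip : ∀ w w' x, ‖Matrix.toEuclideanLin (Hess w - Hess w') x‖ ≤ L * ‖w - w'‖ * ‖x‖)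
    (w s : EuclideanSpace ℝ (Fin d)) :
    ‖Matrix.toEuclideanLin (Hess w) (w - s) - (g w - g s)‖ ≤ L / 2 * ‖w - s‖ ^ 2 := by
  set e := w - s with he
  let f : ℝ → EuclideanSpace ℝ (Fin d) := fun t =>
    g (w - t • e) - g w + t • Matrix.toEuclideanLin (Hess w) e
  have hf : ∀ t, HasDerivAt f (Matrix.toEuclideanLin (Hess w - Hess (w - t • e)) e) t := by
    intro t
    have h1 : HasDerivAt (fun t : ℝ => w - t • e) (-e) t := by
      simpa using ((hasDerivAt_id t).smul_const e).const_sub w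
    have h2 := (hg (w - t • e)).hasFDerivAt.comp_hasDerivAt t h1
    have h3 := (h2.sub_const (g w)).add
      ((hasDerivAt_id t).smul_const (Matrix.toEuclideanLin (Hess w) e))
    refine h3.congr_deriv ?_
    rw [hHess]
    simp only [map_neg, map_sub, LinearMap.sub_apply, one_smul]
    abel
  have hB : ∀ t : ℝ, HasDerivAt (fun t : ℝ => L / 2 * ‖e‖ ^ 2 * t ^ 2) (L * t * ‖e‖ ^ 2) t := by
    intro t
    refine ((hasDerivAt_pow 2 t).const_mul (L / 2 * ‖e‖ ^ 2)).congr_deriv ?_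
    norm_num
    ring
  have key := image_norm_le_of_norm_deriv_right_le_deriv_boundary (a := 0) (b := 1)
    (f := f) (f' := fun t => Matrix.toEuclideanLin (Hess w - Hess (w - t • e)) e)
    (fun t _ => (hf t).continuousAt.continuousWithinAt)
    (fun t _ => (hf t).hasDerivWithinAt) (B := fun t : ℝ => L / 2 * ‖e‖ ^ 2 * t ^ 2)
    (B' := fun t => L * t * ‖e‖ ^ 2) (by simp [f]) hB
    (fun t ht => by
      refine (hLip _ _ _).trans (le_of_eq ?_)
      rw [sub_sub_cancel, norm_smul, Real.norm_of_nonneg ht.1]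
      ring)
    (Set.right_mem_Icc.2 zero_le_one)
  have h1 : f 1 = Matrix.toEuclideanLin (Hess w) e - (g w - g s) := by
    simp only [f, one_smul, he, sub_sub_cancel]
    abel
  rw [h1] at key
  simpa using key

/-- local convergence of one step of sub-sampled proximal Newton,
`w_{t+1} = prox_r^{H̃_t}(w_t − H̃_t⁻¹∇F(w_t))`, for a non-quadratic smooth part. -/
theorem sspn_local_convergence {d : ℕ}
    (F : EuclideanSpace ℝ (Fin d) → ℝ)
    (hFconv : ConvexOn ℝ Set.univ F) (hF : ContDiff ℝ 2 F)
    (L : ℝ)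
    (Hess : EuclideanSpace ℝ (Fin d) → Matrix (Fin d) (Fin d) ℝ)
    (hHess : ∀ w y, fderiv ℝ (gradient F) w y = Matrix.toEuclideanLin (Hess w) y)
    (hLip : ∀ w w' x, ‖Matrix.toEuclideanLin (Hess w - Hess w') x‖ ≤ L * ‖w - w'‖ * ‖x‖)
    (r : EuclideanSpace ℝ (Fin d) → ℝ) (hr : ConvexOn ℝ Set.univ r)
    (wstar : EuclideanSpace ℝ (Fin d)) (hmin : ∀ w, F wstar + r wstar ≤ F w + r w)
    (wt : EuclideanSpace ℝ (Fin d)) (hHt : (Hess wt).PosDef)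
    (ε : ℝ) (hε : 0 < ε ∧ ε ≤ 1 / 2)
    (Htil : Matrix (Fin d) (Fin d) ℝ) (hHtil : Htil.PosDef)
    (happrox : (Htil - (1 - ε) • Hess wt).PosSemidef ∧ ((1 + ε) • Hess wt - Htil).PosSemidef)
    (wnext : EuclideanSpace ℝ (Fin d))
    (hwnext : ∀ z,
      (1 / 2) * normHE Htil (wnext -
          (wt - Matrix.toEuclideanLin Htil⁻¹ (gradient F wt))) ^ 2 + r wnext ≤
        (1 / 2) * normHE Htil (z -
          (wt - Matrix.toEuclideanLin Htil⁻¹ (gradient F wt))) ^ 2 + r z) :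
    ‖wnext - wstar‖ ≤
      2 * ε * Real.sqrt (sMax hHt.1 / sMin hHt.1) * ‖wt - wstar‖
        + (L / sMin hHt.1) * ‖wt - wstar‖ ^ 2 := by
  rcases isEmpty_or_nonempty (Fin d) with hd | hd
  · have h0 : ∀ x : EuclideanSpace ℝ (Fin d), x = 0 := fun x => Subsingleton.elim _ _
    rw [h0 (wnext - wstar), h0 (wt - wstar)]
    simp
  have hL : 0 ≤ L := by
    obtain ⟨x, hx⟩ := exists_ne (0 : EuclideanSpace ℝ (Fin d))
    have h := (norm_nonneg _).trans (hLip x 0 x)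
    have hx' := norm_pos_iff.2 hx
    rw [sub_zero, mul_assoc] at h
    exact nonneg_of_mul_nonneg_left h (mul_pos hx' hx')
  have hFd : Differentiable ℝ F := hF.differentiable (by norm_num)
  have hg : Differentiable ℝ (gradient F) := by
    have h1 : Differentiable ℝ (fderiv ℝ F) :=
      (hF.fderiv_right (m := 1) (by norm_num)).differentiable (by norm_num)
    exact ((InnerProductSpace.toDual ℝ (EuclideanSpace ℝ (Fin d))).symm.toContinuousLinearEquiv.differentiable).comp h1
  have hT := aux_taylor (gradient F) hg L Hess hHess hLip wt wstar
  have hmpos := aux_sMin_pos hHt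
  set g := gradient F with hgdef
  have hopt1 : 0 ≤ ⟪g wstar, wnext - wstar⟫ + (r wnext - r wstar) := by
    refine aux_conv r F hr wstar wnext hmin _ ?_
    have h1 : HasDerivAt (fun t : ℝ => wstar + t • (wnext - wstar)) (wnext - wstar) 0 := by
      simpa using ((hasDerivAt_id (0:ℝ)).smul_const (wnext - wstar)).const_add wstar
    have h2 : HasFDerivAt F (InnerProductSpace.toDual ℝ _ (g wstar))
        (wstar + (0:ℝ) • (wnext - wstar)) := by
      rw [zero_smul, add_zero]
      exact (hFd wstar).hasGradientAt.hasFDerivAt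
    exact h2.comp_hasDerivAt (0:ℝ) h1
  have hcancel : Matrix.toEuclideanLin Htil (Matrix.toEuclideanLin Htil⁻¹ (g wt)) = g wt := by
    have : Htil * Htil⁻¹ = 1 := Matrix.mul_nonsing_inv _ (Matrix.isUnit_iff_isUnit_det _ |>.1 hHtil.isUnit)
    ext j
    simp [Matrix.toEuclideanLin, Matrix.mulVec_mulVec, this]
  have hopt2 : 0 ≤ ⟪Matrix.toEuclideanLin Htil (wnext - wt) + g wt, wstar - wnext⟫
      + (r wstar - r wnext) := by
    set c := wt - Matrix.toEuclideanLin Htil⁻¹ (g wt) with hc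
    have hsq : ∀ x, normHE Htil x ^ 2 = ⟪x, Matrix.toEuclideanLin Htil x⟫ := fun x =>
      Real.sq_sqrt (aux_psd hHtil.posSemidef x)
    refine aux_conv r (fun z => (1 / 2) * normHE Htil (z - c) ^ 2) hr wnext wstar hwnext _ ?_
    set δ := wstar - wnext with hδ
    have hHc : Matrix.toEuclideanLin Htil (wnext - wt) + g wt
        = Matrix.toEuclideanLin Htil (wnext - c) := by
      rw [hc, ← sub_add, map_add, hcancel]
    rw [hHc]
    have hfun : (fun t : ℝ => (1 / 2) * normHE Htil (wnext + t • δ - c) ^ 2) = fun t : ℝ =>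
        (1/2) * ⟪wnext - c, Matrix.toEuclideanLin Htil (wnext - c)⟫
        + t * ⟪Matrix.toEuclideanLin Htil (wnext - c), δ⟫
        + (1/2) * ⟪δ, Matrix.toEuclideanLin Htil δ⟫ * t ^ 2 := by
      funext t
      have e1 : wnext + t • δ - c = (wnext - c) + t • δ := by abel
      rw [hsq, e1]
      generalize wnext - c = u
      have e2 : ⟪u, Matrix.toEuclideanLin Htil δ⟫ = ⟪Matrix.toEuclideanLin Htil u, δ⟫ :=
        (aux_symm hHtil.1 _ _).symm
      have e3 : ⟪δ, Matrix.toEuclideanLin Htil u⟫ = ⟪Matrix.toEuclideanLin Htil u, δ⟫ :=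
        real_inner_comm _ _
      simp only [map_add, map_smul, inner_add_left, inner_add_right,
        inner_smul_left, inner_smul_right, conj_trivial, e2, e3]
      ring
    rw [hfun]
    have h := (((hasDerivAt_id (0:ℝ)).mul_const
      ⟪Matrix.toEuclideanLin Htil (wnext - c), δ⟫).const_add
      ((1/2) * ⟪wnext - c, Matrix.toEuclideanLin Htil (wnext - c)⟫)).add
      ((hasDerivAt_pow 2 (0:ℝ)).const_mul ((1/2) * ⟪δ, Matrix.toEuclideanLin Htil δ⟫))
    refine h.congr_deriv ?_
    simp
  by_cases hΔ0 : wnext - wstar = 0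
  · have := Real.sqrt_nonneg (sMax hHt.1 / sMin hHt.1)
    have := hε.1
    rw [hΔ0, norm_zero]
    positivity
  set Δ := wnext - wstar with hΔ
  set e := wt - wstar with he
  have hmain : ⟪Δ, Matrix.toEuclideanLin Htil Δ⟫ ≤
      ⟪Δ, Matrix.toEuclideanLin (Htil - Hess wt) e⟫
      + ⟪Δ, Matrix.toEuclideanLin (Hess wt) e - (g wt - g wstar)⟫ := by
    have e1 : wstar - wnext = -Δ := by rw [hΔ]; abel
    have e2 : wnext - wt = Δ - e := by rw [hΔ, he]; abel
    rw [e1, e2, real_inner_comm] at hopt2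
    rw [real_inner_comm] at hopt1
    simp only [map_sub, LinearMap.sub_apply, inner_sub_right, inner_add_right, inner_neg_left] at *
    linarith
  set H := Hess wt with hH
  have hlow : (1 - ε) * ⟪Δ, Matrix.toEuclideanLin H Δ⟫ ≤ ⟪Δ, Matrix.toEuclideanLin Htil Δ⟫ := by
    have := aux_psd happrox.1 Δ
    simp only [map_sub, map_smul, LinearMap.sub_apply, LinearMap.smul_apply, inner_sub_right,
      inner_smul_right] at this
    linarith
  have h2nd : ⟪Δ, Matrix.toEuclideanLin H e - (g wt - g wstar)⟫ ≤ ‖Δ‖ * (L / 2 * ‖e‖ ^ 2) :=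
    (real_inner_le_norm _ _).trans (mul_le_mul_of_nonneg_left hT (norm_nonneg _))
  set m := sMin hHt.1 with hm
  set M := sMax hHt.1 with hM
  have hnn : ∀ x, 0 ≤ ⟪x, Matrix.toEuclideanLin H x⟫ := aux_psd hHt.posSemidef
  obtain ⟨a, ha⟩ : ∃ a, a = Real.sqrt ⟪e, Matrix.toEuclideanLin H e⟫ := ⟨_, rfl⟩
  obtain ⟨b, hb⟩ : ∃ b, b = Real.sqrt ⟪Δ, Matrix.toEuclideanLin H Δ⟫ := ⟨_, rfl⟩
  have ha2 : ⟪e, Matrix.toEuclideanLin H e⟫ = a ^ 2 := by rw [ha, Real.sq_sqrt (hnn _)]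
  have hb2 : ⟪Δ, Matrix.toEuclideanLin H Δ⟫ = b ^ 2 := by rw [hb, Real.sq_sqrt (hnn _)]
  have ha0 : 0 ≤ a := ha ▸ Real.sqrt_nonneg _
  have hb0 : 0 ≤ b := hb ▸ Real.sqrt_nonneg _
  have hsm : 0 < Real.sqrt m := Real.sqrt_pos.2 hmpos
  have hbl : Real.sqrt m * ‖Δ‖ ≤ b := by
    rw [hb]
    refine Real.le_sqrt_of_sq_le ?_
    rw [mul_pow, Real.sq_sqrt hmpos.le]
    exact aux_lo hHt.1 Δ
  have hΔpos : 0 < ‖Δ‖ := norm_pos_iff.2 hΔ0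
  have hbpos : 0 < b := lt_of_lt_of_le (mul_pos hsm hΔpos) hbl
  have hau : a ≤ Real.sqrt M * ‖e‖ := by
    have := aux_hi hHt.1 e
    calc a ≤ Real.sqrt (M * ‖e‖ ^ 2) := ha ▸ Real.sqrt_le_sqrt this
      _ = _ := by rw [Real.sqrt_mul' _ (sq_nonneg _), Real.sqrt_sq (norm_nonneg _)]
  have h1st : ⟪Δ, Matrix.toEuclideanLin (Htil - H) e⟫ ≤ ε * a * b := by
    by_cases he0 : e = 0
    · rw [he0, map_zero, inner_zero_right]
      have := hε.1
      positivity
    have hapos : 0 < a := by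
      have h1 := aux_lo hHt.1 e
      have h2 : 0 < m * ‖e‖ ^ 2 := mul_pos hmpos (pow_pos (norm_pos_iff.2 he0) 2)
      rw [ha]
      exact Real.sqrt_pos.2 (h2.trans_le h1)
    refine aux_cs (H := H) (hHtil.1.sub hHt.1) ε ?_ ?_ e Δ a b hapos hbpos ha2 hb2
    · intro x
      have := aux_psd happrox.2 x
      simp only [map_sub, map_smul, LinearMap.sub_apply, LinearMap.smul_apply, inner_sub_right,
        inner_smul_right] at this ⊢
      linarith
    · intro x
      have := aux_psd happrox.1 x
      simp only [map_sub, map_smul, LinearMap.sub_apply, LinearMap.smul_apply, inner_sub_right,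
        inner_smul_right] at this ⊢
      linarith
  rw [hb2] at hlow
  have hΔb : ‖Δ‖ ≤ b / Real.sqrt m := by rw [le_div_iff₀ hsm]; linarith
  have hq : 0 ≤ L / 2 * ‖e‖ ^ 2 := by positivity
  have hstep : (1 - ε) * b ≤ ε * a + (L / 2 * ‖e‖ ^ 2) / Real.sqrt m := by
    refine le_of_mul_le_mul_right ?_ hbpos
    have := mul_le_mul_of_nonneg_right hΔb hq
    calc (1 - ε) * b * b = (1 - ε) * b ^ 2 := by ring
      _ ≤ ε * a * b + b / Real.sqrt m * (L / 2 * ‖e‖ ^ 2) := by linarith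
      _ = _ := by ring
  have hbb : b ≤ 2 * ε * (Real.sqrt M * ‖e‖) + L * ‖e‖ ^ 2 / Real.sqrt m := by
    have h1 : ε * a ≤ ε * (Real.sqrt M * ‖e‖) := mul_le_mul_of_nonneg_left hau hε.1.le
    have h2 : (1 / 2) * b ≤ (1 - ε) * b := mul_le_mul_of_nonneg_right (by linarith [hε.2]) hb0
    have h3 : (L / 2 * ‖e‖ ^ 2) / Real.sqrt m = (1 / 2) * (L * ‖e‖ ^ 2 / Real.sqrt m) := by ring
    linarith
  calc ‖Δ‖ ≤ b / Real.sqrt m := hΔb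
    _ ≤ (2 * ε * (Real.sqrt M * ‖e‖) + L * ‖e‖ ^ 2 / Real.sqrt m) / Real.sqrt m :=
      div_le_div_of_nonneg_right hbb hsm.le
    _ = 2 * ε * (Real.sqrt M / Real.sqrt m) * ‖e‖ + L / (Real.sqrt m * Real.sqrt m) * ‖e‖ ^ 2 := by
      field_simp
    _ = _ := by rw [Real.mul_self_sqrt hmpos.le, Real.sqrt_div' _ hmpos.le]
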